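/- Let 0 < α < 1, T > 0, κ > 0, K > 0, c_L > 0, c_M > 0, and set γ = max(0, κ − 1). There exists a constant C > 0 (depending only on α, T, κ, K, c_L, c_M) with the following property. Let (λ_ξ)_{ξ∈ℕ} and (μ_ξ)_{ξ∈ℕ} be real sequences with c_L ≤ λ_ξ ≤ K μ_ξ^κ and μ_ξ ≥ c_M for all ξ, set ν_ξ = μ_ξ/(1+λ_ξ), and let (φ_ξ), (ψ_ξ) be real sequences with ∑_ξ μ_ξ^{2(1+γ)} ( |φ_ξ|² + |ψ_ξ|² ) < ∞. Define f_ξ = μ_ξ φ_ξ − μ_ξ (φ_ξ − ψ_ξ) / (1 − E_{α,1}(−ν_ξ T^α)). Then the sequence (f_ξ) is square-summable and ∑_ξ |f_ξ|² ≤ C ( ∑_ξ μ_ξ² |φ_ξ|² + ∑_ξ μ_ξ^{2(1+γ)} ( |φ_ξ|² + |ψ_ξ|² ) ). -/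

import Mathlib

/-- The Mittag-Leffler function `E_{α,β}(z) = ∑_{m=0}^∞ z^m / Γ(α m + β)`. -/
noncomputable def mittagLeffler (α β z : ℝ) : ℝ :=
  ∑' m : ℕ, z ^ m / Real.Gamma (α * m + β)

noncomputable def mlQ (α : ℝ) (N n : ℕ) : ℝ :=
  ((N : ℝ) + 1) ^ ((1 - α) * n) * ∏ j ∈ Finset.range (N + 2), (α * n + 1 + j) / ((n : ℝ) + 1 + j)

theorem ml_gamma_lower (s R : ℝ) (hs : 0 ≤ s) (hR : 0 < R) :
    R ^ s * Real.exp (-R) ≤ Real.Gamma (s + 1) := by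
  rw [Real.Gamma_eq_integral (by linarith)]
  have h1 : R ^ s * Real.exp (-R) = ∫ t in Set.Ioi R, R ^ s * Real.exp (-t) := by
    rw [MeasureTheory.integral_const_mul, integral_exp_neg_Ioi]
  have hint := Real.GammaIntegral_convergent (s := s + 1) (by linarith)
  have hsub : Set.Ioi R ⊆ Set.Ioi (0 : ℝ) := Set.Ioi_subset_Ioi hR.le
  rw [h1]
  refine le_trans (MeasureTheory.setIntegral_mono_on ?_ (hint.mono_set hsub) measurableSet_Ioi ?_)
    (MeasureTheory.setIntegral_mono_set hint ?_ (Filter.Eventually.of_forall hsub))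
  · exact (integrableOn_exp_neg_Ioi R).const_mul _
  · intro t ht
    rw [mul_comm, add_sub_cancel_right]
    have : R ^ s ≤ t ^ s := Real.rpow_le_rpow hR.le (le_of_lt ht) hs
    gcongr
  · filter_upwards [MeasureTheory.ae_restrict_mem measurableSet_Ioi] with t ht
    have : (0 : ℝ) < t := ht
    positivity

theorem ml_summable (α : ℝ) (hα : 0 < α) (x : ℝ) (hx : 0 ≤ x) :
    Summable (fun n : ℕ => x ^ n / Real.Gamma (α * n + 1)) := by
  set R : ℝ := (2 * x + 1) ^ (1 / α) with hR
  have hRp : 0 < R := by positivity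
  have hRa : R ^ α = 2 * x + 1 := by
    rw [hR, ← Real.rpow_mul (by positivity), one_div_mul_cancel hα.ne', Real.rpow_one]
  have hg : Summable (fun n : ℕ => Real.exp R * (x / (2 * x + 1)) ^ n) := by
    apply Summable.mul_left
    apply summable_geometric_of_lt_one (by positivity)
    rw [div_lt_one (by positivity)]; linarith
  refine Summable.of_nonneg_of_le (fun n => ?_) (fun n => ?_) hg
  · have : 0 < Real.Gamma (α * n + 1) := Real.Gamma_pos_of_pos (by positivity)
    positivity
  · have h := ml_gamma_lower (α * n) R (by positivity) hRp
    rw [Real.rpow_mul hRp.le, hRa, Real.rpow_natCast] at h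
    have hp : 0 < (2 * x + 1) ^ n * Real.exp (-R) := by positivity
    calc x ^ n / Real.Gamma (α * n + 1) ≤ x ^ n / ((2 * x + 1) ^ n * Real.exp (-R)) := by gcongr
      _ = _ := by
        rw [Real.exp_neg, div_pow]; field_simp

theorem mlQ_nonneg (α : ℝ) (hα : 0 < α) (N n : ℕ) : 0 ≤ mlQ α N n := by
  unfold mlQ
  positivity

theorem mlQ_mono (α : ℝ) (hα : 0 < α) (hα1 : α < 1) (n : ℕ) : Monotone (fun N => mlQ α N n) := by
  apply monotone_nat_of_le_succ
  intro N
  unfold mlQ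
  rw [Finset.prod_range_succ _ (N + 2)]
  set P := ∏ j ∈ Finset.range (N + 2), (α * n + 1 + j) / ((n : ℝ) + 1 + j) with hP
  have hPn : 0 ≤ P := by positivity
  have e : (((N + 1 : ℕ) : ℝ) + 1) = ((N : ℝ) + 1) * (((N : ℝ) + 2) / (N + 1)) := by
    push_cast; field_simp; ring
  rw [e, Real.mul_rpow (by positivity) (by positivity)]
  have hβ : 0 < 1 - α := by linarith
  have key : 1 ≤ (((N : ℝ) + 2) / (N + 1)) ^ ((1 - α) * n) *
      ((α * n + 1 + ((N + 2 : ℕ) : ℝ)) / ((n : ℝ) + 1 + ((N + 2 : ℕ) : ℝ))) := by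
    have h1 : 1 + (1 - α) * n / (N + 3) ≤ (((N : ℝ) + 2) / (N + 1)) ^ ((1 - α) * n) := by
      rw [Real.rpow_def_of_pos (by positivity)]
      have h2 := Real.one_sub_inv_le_log_of_pos (x := ((N : ℝ) + 2) / (N + 1)) (by positivity)
      have h3 : (1 : ℝ) / (N + 3) ≤ 1 - (((N : ℝ) + 2) / (N + 1))⁻¹ := by
        have : 1 - (((N : ℝ) + 2) / (N + 1))⁻¹ = 1 / (N + 2) := by field_simp; ring
        rw [this]
        gcongr
        norm_num
      have h4 := Real.add_one_le_exp (Real.log (((N : ℝ) + 2) / (N + 1)) * ((1 - α) * n))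
      have h5 : (1 : ℝ) / (N + 3) * ((1 - α) * n) ≤
          Real.log (((N : ℝ) + 2) / (N + 1)) * ((1 - α) * n) := by
        apply mul_le_mul_of_nonneg_right (h3.trans h2); positivity
      have h6 : (1 - α) * n / ((N : ℝ) + 3) = 1 / (N + 3) * ((1 - α) * n) := by ring
      rw [h6]; linarith
    refine le_trans ?_ (mul_le_mul_of_nonneg_right h1 (by positivity))
    push_cast
    have : (1 + (1 - α) * n / ((N : ℝ) + 3)) * ((α * n + 1 + (N + 2)) / (n + 1 + (N + 2)))
      = ((N + 3 + (1 - α) * n) * (α * n + N + 3)) / ((N + 3) * (n + N + 3)) := by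
      field_simp; ring
    rw [this, le_div_iff₀ (by positivity)]
    have : 0 ≤ (1 - α) * n * (α * n) := by positivity
    nlinarith
  have h0 : 0 ≤ ((N : ℝ) + 1) ^ ((1 - α) * n) * P := by positivity
  calc _ ≤ ((N : ℝ) + 1) ^ ((1 - α) * n) * P * _ := le_mul_of_one_le_right h0 key
    _ = _ := by ring

theorem mlQ_tendsto (α : ℝ) (hα : 0 < α) (n : ℕ) :
    Filter.Tendsto (fun N => mlQ α N n) Filter.atTop
      (nhds (n.factorial / Real.Gamma (α * n + 1))) := by
  have h1 := (Real.GammaSeq_tendsto_Gamma ((n : ℝ) + 1)).comp (Filter.tendsto_add_atTop_nat 1)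
  have h2 := (Real.GammaSeq_tendsto_Gamma (α * n + 1)).comp (Filter.tendsto_add_atTop_nat 1)
  rw [Real.Gamma_nat_eq_factorial] at h1
  have h3 := h1.div h2 (Real.Gamma_pos_of_pos (by positivity)).ne'
  refine h3.congr (fun N => ?_)
  simp only [Function.comp, Pi.div_apply, Real.GammaSeq, mlQ]
  rw [Finset.prod_div_distrib]
  have a1 : 0 < ∏ j ∈ Finset.range (N + 2), (α * n + 1 + j) := by
    apply Finset.prod_pos; intros; positivity
  have a2 : 0 < ∏ j ∈ Finset.range (N + 2), ((n : ℝ) + 1 + j) := by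
    apply Finset.prod_pos; intros; positivity
  have e : (((N + 1 : ℕ) : ℝ)) ^ ((n : ℝ) + 1) =
      ((N + 1 : ℕ) : ℝ) ^ (α * n + 1) * ((N : ℝ) + 1) ^ ((1 - α) * n) := by
    push_cast
    rw [← Real.rpow_add (by positivity)]
    congr 1; ring
  rw [e]
  have : (0 : ℝ) < ((N + 1 : ℕ) : ℝ) ^ (α * n + 1) := by positivity
  have : (0 : ℝ) < ((N + 1).factorial : ℝ) := by positivity
  rw [show N + 1 + 1 = N + 2 from rfl]
  field_simp

theorem mlQ_le (α : ℝ) (hα : 0 < α) (hα1 : α < 1) (N n : ℕ) :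
    mlQ α N n ≤ n.factorial / Real.Gamma (α * n + 1) :=
  (mlQ_mono α hα hα1 n).ge_of_tendsto (mlQ_tendsto α hα n) N

/-- exponential generating function -/
noncomputable def mlG (a : ℕ → ℝ) (x : ℝ) : ℝ := ∑' n : ℕ, a n * ((-x) ^ n / n.factorial)

theorem mlG_summable (a : ℕ → ℝ) (ha : ∀ n, |a n| ≤ 1) (x : ℝ) :
    Summable (fun n : ℕ => a n * ((-x) ^ n / n.factorial)) := by
  refine Summable.of_norm_bounded (Real.summable_pow_div_factorial |x|) (fun n => ?_)
  rw [Real.norm_eq_abs, abs_mul, abs_div, abs_pow, abs_neg, Nat.abs_cast]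
  exact mul_le_of_le_one_left (by positivity) (ha n)

theorem mlG_integral (a : ℕ → ℝ) (ha : ∀ n, |a n| ≤ 1) (j : ℕ) (x : ℝ) :
    IntervalIntegrable (fun t : ℝ => ((j : ℝ) + 1) * t ^ j * mlG a (x * t)) MeasureTheory.volume 0 1 ∧
    mlG (fun n => a n * (((j : ℝ) + 1) / (n + 1 + j))) x =
      ∫ t in (0 : ℝ)..1, ((j : ℝ) + 1) * t ^ j * mlG a (x * t) := by
  have hb : ∀ n : ℕ, ∀ t ∈ Set.Icc (0 : ℝ) 1, ‖a n * ((-(x * t)) ^ n / n.factorial)‖ ≤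
      |x| ^ n / n.factorial := by
    intro n t ht
    rw [Real.norm_eq_abs, abs_mul, abs_div, abs_pow, abs_neg, Nat.abs_cast, abs_mul]
    refine (mul_le_of_le_one_left (by positivity) (ha n)).trans ?_
    gcongr
    exact mul_le_of_le_one_right (abs_nonneg _) (by rw [abs_of_nonneg ht.1]; exact ht.2)
  have hc : ContinuousOn (fun t => mlG a (x * t)) (Set.Icc 0 1) := by
    unfold mlG
    exact continuousOn_tsum (fun n => by fun_prop) (Real.summable_pow_div_factorial |x|) hb
  refine ⟨?_, ?_⟩
  · apply ContinuousOn.intervalIntegrable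
    rw [Set.uIcc_of_le zero_le_one]
    exact (by fun_prop : ContinuousOn (fun t : ℝ => ((j : ℝ) + 1) * t ^ j) (Set.Icc 0 1)).mul hc
  · have hs := intervalIntegral.hasSum_integral_of_dominated_convergence (a := (0 : ℝ)) (b := 1)
      (μ := MeasureTheory.volume) (ι := ℕ)
      (F := fun n t => ((j : ℝ) + 1) * t ^ j * (a n * ((-(x * t)) ^ n / n.factorial)))
      (f := fun t => ((j : ℝ) + 1) * t ^ j * mlG a (x * t))
      (fun n _ => ((j : ℝ) + 1) * (|x| ^ n / n.factorial)) ?_ ?_ ?_ ?_ ?_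
    · rw [← hs.tsum_eq, mlG]
      congr 1
      ext n
      have e : ∀ t : ℝ, ((j : ℝ) + 1) * t ^ j * (a n * ((-(x * t)) ^ n / n.factorial)) =
          (((j : ℝ) + 1) * a n * ((-x) ^ n / n.factorial)) * t ^ (j + n) := by
        intro t
        rw [← neg_mul, mul_pow, pow_add]; ring
      simp_rw [e]
      rw [intervalIntegral.integral_const_mul, integral_pow]
      push_cast
      simp
      field_simp
      ring
    · intro n
      exact (by fun_prop : Continuous _).aestronglyMeasurable
    · intro n
      refine Filter.Eventually.of_forall (fun t ht => ?_)
      rw [Set.uIoc_of_le zero_le_one] at ht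
      rw [norm_mul]
      have h1 := hb n t ⟨ht.1.le, ht.2⟩
      have h2 : ‖((j : ℝ) + 1) * t ^ j‖ ≤ (j : ℝ) + 1 := by
        rw [Real.norm_of_nonneg (by have := ht.1; positivity)]
        exact mul_le_of_le_one_right (by positivity) (pow_le_one₀ ht.1.le ht.2)
      gcongr
    · refine Filter.Eventually.of_forall (fun t _ => ?_)
      exact (Real.summable_pow_div_factorial |x|).mul_left _
    · simp
    · refine Filter.Eventually.of_forall (fun t _ => ?_)
      exact (mlG_summable a ha (x * t)).hasSum.mul_left _

theorem mlG_step (α : ℝ) (hα : 0 < α) (hα1 : α < 1) (a : ℕ → ℝ) (ha : ∀ n, |a n| ≤ 1) (j : ℕ)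
    (h : AntitoneOn (mlG a) (Set.Ici 0)) :
    AntitoneOn (mlG (fun n => a n * ((α * n + 1 + j) / ((n : ℝ) + 1 + j)))) (Set.Ici 0) := by
  have ha' : ∀ n : ℕ, |a n * (((j : ℝ) + 1) / (n + 1 + j))| ≤ 1 := by
    intro n
    rw [abs_mul]
    refine mul_le_one₀ (ha n) (abs_nonneg _) ?_
    rw [abs_of_nonneg (by positivity), div_le_one (by positivity)]
    have : (0 : ℝ) ≤ n := by positivity
    linarith
  have e : ∀ x, mlG (fun n => a n * ((α * n + 1 + j) / ((n : ℝ) + 1 + j))) x =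
      α * mlG a x + (1 - α) * mlG (fun n => a n * (((j : ℝ) + 1) / (n + 1 + j))) x := by
    intro x
    unfold mlG
    rw [← tsum_mul_left, ← tsum_mul_left, ← Summable.tsum_add
      ((mlG_summable a ha x).mul_left _) ((mlG_summable _ ha' x).mul_left _)]
    congr 1
    ext n
    field_simp
    ring
  intro x hx y hy hxy
  simp only [Set.mem_Ici] at hx hy
  rw [e, e]
  have h1 : mlG a y ≤ mlG a x := h hx hy hxy
  have h2 : mlG (fun n => a n * (((j : ℝ) + 1) / (n + 1 + j))) y ≤
      mlG (fun n => a n * (((j : ℝ) + 1) / (n + 1 + j))) x := by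
    rw [(mlG_integral a ha j x).2, (mlG_integral a ha j y).2]
    refine intervalIntegral.integral_mono_on zero_le_one (mlG_integral a ha j y).1
      (mlG_integral a ha j x).1 (fun t ht => ?_)
    have ht0 := ht.1
    have : mlG a (y * t) ≤ mlG a (x * t) :=
      h (mul_nonneg hx ht0) (mul_nonneg hy ht0) (mul_le_mul_of_nonneg_right hxy ht0)
    gcongr
  have : 0 ≤ 1 - α := by linarith
  gcongr

theorem mlG_prod (α : ℝ) (hα : 0 < α) (hα1 : α < 1) (N : ℕ) :
    (∀ n : ℕ, |∏ j ∈ Finset.range N, (α * n + 1 + j) / ((n : ℝ) + 1 + j)| ≤ 1) ∧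
    AntitoneOn (mlG (fun n : ℕ => ∏ j ∈ Finset.range N, (α * n + 1 + j) / ((n : ℝ) + 1 + j)))
      (Set.Ici 0) := by
  induction N with
  | zero =>
    refine ⟨by simp, ?_⟩
    have : ∀ x, mlG (fun n : ℕ => ∏ j ∈ Finset.range 0, (α * n + 1 + j) / ((n : ℝ) + 1 + j)) x
        = Real.exp (-x) := by
      intro x
      simp [mlG, Real.exp_eq_exp_ℝ, NormedSpace.exp_eq_tsum_div]
    intro x _ y _ hxy
    rw [this, this]
    exact Real.exp_le_exp.2 (by linarith)
  | succ N ih =>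
    simp_rw [Finset.prod_range_succ]
    refine ⟨fun n => ?_, mlG_step α hα hα1 _ ih.1 N ih.2⟩
    rw [abs_mul]
    refine mul_le_one₀ (ih.1 n) (abs_nonneg _) ?_
    rw [abs_of_nonneg (by positivity), div_le_one (by positivity)]
    have : (0 : ℝ) ≤ n := by positivity
    nlinarith

theorem ml_antitone (α : ℝ) (hα : 0 < α) (hα1 : α < 1) :
    AntitoneOn (fun x => mittagLeffler α 1 (-x)) (Set.Ici 0) := by
  have lim : ∀ x : ℝ, 0 ≤ x → Filter.Tendsto
      (fun N : ℕ => mlG (fun n : ℕ => ∏ j ∈ Finset.range (N + 2), (α * n + 1 + j) / ((n : ℝ) + 1 + j))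
        (((N : ℝ) + 1) ^ (1 - α) * x)) Filter.atTop (nhds (mittagLeffler α 1 (-x))) := by
    intro x hx
    have e : ∀ N : ℕ, mlG (fun n : ℕ => ∏ j ∈ Finset.range (N + 2),
        (α * n + 1 + j) / ((n : ℝ) + 1 + j)) (((N : ℝ) + 1) ^ (1 - α) * x) =
        ∑' n : ℕ, mlQ α N n * ((-x) ^ n / n.factorial) := by
      intro N
      unfold mlG mlQ
      congr 1
      ext n
      rw [← mul_neg, mul_pow, Real.rpow_mul (by positivity), Real.rpow_natCast]
      ring
    simp_rw [e]
    unfold mittagLeffler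
    refine tendsto_tsum_of_dominated_convergence (ml_summable α hα x hx) (fun n => ?_)
      (Filter.Eventually.of_forall fun N n => ?_)
    · have := (mlQ_tendsto α hα n).mul_const ((-x) ^ n / n.factorial)
      convert this using 2
      have : (0 : ℝ) < n.factorial := by positivity
      field_simp
    · rw [Real.norm_eq_abs, abs_mul, abs_of_nonneg (mlQ_nonneg α hα N n), abs_div, abs_pow, abs_neg,
        Nat.abs_cast, abs_of_nonneg hx]
      calc _ ≤ n.factorial / Real.Gamma (α * n + 1) * (x ^ n / n.factorial) := by
            gcongr
            exact mlQ_le α hα hα1 N n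
        _ = _ := by
            have : (0 : ℝ) < n.factorial := by positivity
            field_simp
  intro x hx y hy hxy
  simp only [Set.mem_Ici] at hx hy
  refine le_of_tendsto_of_tendsto' (lim y hy) (lim x hx) (fun N => ?_)
  refine (mlG_prod α hα hα1 (N + 2)).2 ?_ ?_ ?_
  · exact Set.mem_Ici.2 (by positivity)
  · exact Set.mem_Ici.2 (by positivity)
  · gcongr

theorem ml_small (α : ℝ) (hα : 0 < α) :
    ∃ g > 0, ∃ B ≥ 0, ∀ x, 0 ≤ x → x ≤ 1 → g * x - B * x ^ 2 ≤ 1 - mittagLeffler α 1 (-x) := by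
  have hG : ∀ n : ℕ, 0 < Real.Gamma (α * n + 1) := fun n => Real.Gamma_pos_of_pos (by positivity)
  have hs1 := (summable_nat_add_iff 2).2 (ml_summable α hα 1 zero_le_one)
  refine ⟨1 / Real.Gamma (α + 1), by have := hG 1; simp at this; positivity,
    ∑' n : ℕ, (1 : ℝ) ^ (n + 2) / Real.Gamma (α * (n + 2 : ℕ) + 1), ?_, ?_⟩
  · exact tsum_nonneg (fun n => by have := hG (n + 2); positivity)
  · intro x hx hx1
    have hb : ∀ n : ℕ, ‖(-x) ^ (n + 2) / Real.Gamma (α * (n + 2 : ℕ) + 1)‖ ≤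
        (1 : ℝ) ^ (n + 2) / Real.Gamma (α * (n + 2 : ℕ) + 1) * x ^ 2 := by
      intro n
      rw [Real.norm_eq_abs, abs_div, abs_pow, abs_neg, abs_of_nonneg hx, abs_of_pos (hG _), one_pow,
        div_mul_eq_mul_div, one_mul, pow_add]
      have := hG (n + 2)
      gcongr
      exact mul_le_of_le_one_left (by positivity) (pow_le_one₀ hx hx1)
    have hsum : Summable (fun n : ℕ => (-x) ^ n / Real.Gamma (α * n + 1)) := by
      refine Summable.of_norm_bounded (ml_summable α hα x hx) (fun n => ?_)
      rw [Real.norm_eq_abs, abs_div, abs_pow, abs_neg, abs_of_nonneg hx, abs_of_pos (hG _)]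
    have h1 := hsum.sum_add_tsum_nat_add 2
    have h2 : ∑' n : ℕ, (-x) ^ (n + 2) / Real.Gamma (α * (n + 2 : ℕ) + 1) ≤
        ∑' n : ℕ, (1 : ℝ) ^ (n + 2) / Real.Gamma (α * (n + 2 : ℕ) + 1) * x ^ 2 :=
      Summable.tsum_le_tsum (fun n => (le_abs_self _).trans (hb n))
        ((summable_nat_add_iff 2).2 hsum) (hs1.mul_right _)
    rw [tsum_mul_right] at h2
    simp only [Finset.sum_range_succ, Finset.sum_range_zero] at h1
    unfold mittagLeffler
    rw [← h1]
    simp only [Nat.cast_zero, mul_zero, zero_add, Real.Gamma_one, pow_zero, Nat.cast_one, mul_one,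
      pow_one, div_one]
    have : -x / Real.Gamma (α + 1) = - (1 / Real.Gamma (α + 1) * x) := by ring
    rw [this]
    linarith

theorem ml_inv_bound (α : ℝ) (hα : 0 < α) (hα1 : α < 1) :
    ∃ A > 0, ∀ x > 0, 0 < 1 - mittagLeffler α 1 (-x) ∧
      1 / (1 - mittagLeffler α 1 (-x)) ≤ A * (1 + 1 / x) := by
  obtain ⟨g, hg, B, hB, h⟩ := ml_small α hα
  set x₀ : ℝ := min 1 (g / (2 * (B + 1))) with hx0
  have hx0p : 0 < x₀ := by positivity
  have hx01 : x₀ ≤ 1 := min_le_left _ _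
  have hx02 : x₀ * (2 * (B + 1)) ≤ g := by
    rw [← le_div_iff₀ (by positivity)]; exact min_le_right _ _
  have hsm : ∀ x, 0 < x → x ≤ x₀ → g / 2 * x ≤ 1 - mittagLeffler α 1 (-x) := by
    intro x hx hxx
    refine le_trans ?_ (h x hx.le (hxx.trans hx01))
    have : B * x ≤ g / 2 := by nlinarith
    nlinarith
  refine ⟨2 / (g * x₀), by positivity, fun x hx => ?_⟩
  have hkey : ∃ y, 0 < y ∧ g / 2 * y ≤ 1 - mittagLeffler α 1 (-x) ∧ 1 / y ≤ (1 + 1 / x) / x₀ := by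
    rcases le_total x x₀ with hxx | hxx
    · refine ⟨x, hx, hsm x hx hxx, ?_⟩
      rw [le_div_iff₀ hx0p]
      have : 1 / x * x₀ ≤ 1 / x * 1 := by gcongr
      linarith
    · refine ⟨x₀, hx0p, (hsm x₀ hx0p le_rfl).trans ?_, ?_⟩
      · have := ml_antitone α hα hα1 (Set.mem_Ici.2 hx0p.le) (Set.mem_Ici.2 hx.le) hxx
        simp only at this
        linarith
      · have : 0 < 1 / x := by positivity
        gcongr
        linarith
  obtain ⟨y, hy, h1, h2⟩ := hkey
  have h3 : 0 < g / 2 * y := by positivity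
  refine ⟨h3.trans_le h1, ?_⟩
  calc 1 / (1 - mittagLeffler α 1 (-x)) ≤ 1 / (g / 2 * y) := by gcongr
    _ = 2 / g * (1 / y) := by field_simp
    _ ≤ 2 / g * ((1 + 1 / x) / x₀) := by gcongr
    _ = _ := by field_simp

/-- Estimate for the source term `f` of the inverse problem. Here
`γ = max(0, κ − 1)` and `f_ξ = μ_ξ φ_ξ − μ_ξ (φ_ξ − ψ_ξ)/(1 − E_{α,1}(−ν_ξ T^α))`. -/
theorem inverse_problem_f_estimate (α T κ K cL cM : ℝ)
    (hα : 0 < α) (hα1 : α < 1) (hT : 0 < T) (hκ : 0 < κ) (hK : 0 < K)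
    (hcL : 0 < cL) (hcM : 0 < cM) :
    ∃ C > 0,
      ∀ lam mu φ ψ : ℕ → ℝ,
        (∀ ξ, cL ≤ lam ξ) → (∀ ξ, lam ξ ≤ K * mu ξ ^ κ) → (∀ ξ, cM ≤ mu ξ) →
        Summable (fun ξ => mu ξ ^ (2 * (1 + max 0 (κ - 1))) *
          ((φ ξ) ^ 2 + (ψ ξ) ^ 2)) →
        ∀ f : ℕ → ℝ,
        (∀ ξ, f ξ = mu ξ * φ ξ -
          mu ξ * ((φ ξ - ψ ξ) /
            (1 - mittagLeffler α 1 (-(mu ξ / (1 + lam ξ)) * T ^ α)))) →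
        Summable (fun ξ => (f ξ) ^ 2) ∧
          ∑' ξ, (f ξ) ^ 2 ≤
            C * ((∑' ξ, mu ξ ^ 2 * (φ ξ) ^ 2) +
              ∑' ξ, mu ξ ^ (2 * (1 + max 0 (κ - 1))) * ((φ ξ) ^ 2 + (ψ ξ) ^ 2)) := by
  obtain ⟨A, hA, hAb⟩ := ml_inv_bound α hα hα1
  set γ := max 0 (κ - 1) with hγ
  have hγ0 : 0 ≤ γ := le_max_left _ _
  have hγ1 : κ - 1 ≤ γ := le_max_right _ _
  set b : ℝ := cM ^ (-γ) with hb
  have hbp : 0 < b := by positivity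
  have hb1 : ∀ m, cM ≤ m → 1 ≤ b * m ^ γ := by
    intro m hm
    have : cM ^ γ ≤ m ^ γ := Real.rpow_le_rpow hcM.le hm hγ0
    calc (1 : ℝ) = b * cM ^ γ := by rw [hb, ← Real.rpow_add hcM]; simp
      _ ≤ _ := by gcongr
  set d : ℝ := cM ^ (κ - 1 - γ) with hd
  have hdp : 0 < d := by positivity
  have hd1 : ∀ m, cM ≤ m → m ^ (κ - 1) ≤ d * m ^ γ := by
    intro m hm
    have hm0 : 0 < m := hcM.trans_le hm
    have h1 : m ^ (κ - 1 - γ) ≤ d := Real.rpow_le_rpow_of_nonpos hcM hm (by linarith)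
    calc m ^ (κ - 1) = m ^ (κ - 1 - γ) * m ^ γ := by rw [← Real.rpow_add hm0]; congr 1; ring
      _ ≤ _ := by gcongr
  set S : ℝ := T ^ α with hS
  have hSp : 0 < S := by positivity
  set M : ℝ := A * (b + (1 / cL + 1) * K / S * d) with hM
  have hMp : 0 < M := by positivity
  have hD : ∀ l m : ℝ, cL ≤ l → l ≤ K * m ^ κ → cM ≤ m →
      0 < 1 - mittagLeffler α 1 (-(m / (1 + l)) * S) ∧
      1 / (1 - mittagLeffler α 1 (-(m / (1 + l)) * S)) ≤ M * m ^ γ := by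
    intro l m hl hlm hm
    have hm0 : 0 < m := hcM.trans_le hm
    have hl0 : 0 < l := hcL.trans_le hl
    have hx : 0 < m / (1 + l) * S := by positivity
    have := hAb _ hx
    rw [neg_mul]
    refine ⟨this.1, this.2.trans ?_⟩
    rw [hM, mul_assoc, add_mul]
    have h1 := hb1 m hm
    have h2 : 1 / (m / (1 + l) * S) ≤ (1 / cL + 1) * K / S * d * m ^ γ := by
      have e1 : 1 + l ≤ (1 / cL + 1) * (K * m ^ κ) := by
        have : 1 ≤ 1 / cL * l := by rw [one_div, inv_mul_eq_div, one_le_div hcL]; exact hl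
        calc 1 + l ≤ (1 / cL + 1) * l := by linarith
          _ ≤ _ := by gcongr
      calc 1 / (m / (1 + l) * S) = (1 + l) / (m * S) := by field_simp
        _ ≤ (1 / cL + 1) * (K * m ^ κ) / (m * S) := by gcongr
        _ = (1 / cL + 1) * K / S * m ^ (κ - 1) := by
            rw [Real.rpow_sub_one hm0.ne']; field_simp
        _ ≤ (1 / cL + 1) * K / S * (d * m ^ γ) := by gcongr; exact hd1 m hm
        _ = _ := by ring
    gcongr
  refine ⟨2 + 4 * M ^ 2, by positivity, ?_⟩
  intro lam mu φ ψ h1 h2 h3 hsum f hf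
  have hpow : ∀ ξ, mu ξ ^ (2 * (1 + γ)) = mu ξ ^ 2 * (mu ξ ^ γ) ^ 2 := by
    intro ξ
    have hm0 : 0 < mu ξ := hcM.trans_le (h3 ξ)
    rw [mul_comm 2, Real.rpow_mul hm0.le, Real.rpow_add hm0, Real.rpow_one, ← mul_pow,
      Real.rpow_two]
  have hs1 : Summable (fun ξ => mu ξ ^ 2 * (φ ξ) ^ 2) := by
    refine Summable.of_nonneg_of_le (fun ξ => by positivity) (fun ξ => ?_) (hsum.mul_left (b ^ 2))
    rw [hpow]
    have e := hb1 _ (h3 ξ)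
    have e2 : 1 ≤ (b * mu ξ ^ γ) ^ 2 := one_le_pow₀ e
    have e3 : φ ξ ^ 2 ≤ φ ξ ^ 2 + ψ ξ ^ 2 := by linarith [sq_nonneg (ψ ξ)]
    calc mu ξ ^ 2 * φ ξ ^ 2 ≤ mu ξ ^ 2 * (φ ξ ^ 2 + ψ ξ ^ 2) := by gcongr
      _ ≤ mu ξ ^ 2 * (φ ξ ^ 2 + ψ ξ ^ 2) * (b * mu ξ ^ γ) ^ 2 :=
        le_mul_of_one_le_right (by positivity) e2
      _ = _ := by ring
  have hle : ∀ ξ, f ξ ^ 2 ≤ (2 + 4 * M ^ 2) * (mu ξ ^ 2 * φ ξ ^ 2 +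
      mu ξ ^ (2 * (1 + γ)) * (φ ξ ^ 2 + ψ ξ ^ 2)) := by
    intro ξ
    obtain ⟨p1, p2⟩ := hD _ _ (h1 ξ) (h2 ξ) (h3 ξ)
    rw [hf ξ, hpow, div_eq_mul_one_div (φ ξ - ψ ξ)]
    set D := 1 / (1 - mittagLeffler α 1 (-(mu ξ / (1 + lam ξ)) * S)) with hDd
    have hD0 : 0 ≤ D := by positivity
    have hD2 : D ^ 2 ≤ (M * mu ξ ^ γ) ^ 2 := by gcongr
    have q1 : (mu ξ * φ ξ - mu ξ * ((φ ξ - ψ ξ) * D)) ^ 2 ≤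
        2 * (mu ξ ^ 2 * φ ξ ^ 2) + 4 * (mu ξ ^ 2 * (φ ξ ^ 2 + ψ ξ ^ 2)) * D ^ 2 := by
      nlinarith [sq_nonneg (mu ξ * φ ξ + mu ξ * ((φ ξ - ψ ξ) * D)),
        sq_nonneg (mu ξ * D * (φ ξ + ψ ξ))]
    have q2 : 4 * (mu ξ ^ 2 * (φ ξ ^ 2 + ψ ξ ^ 2)) * D ^ 2 ≤
        4 * (mu ξ ^ 2 * (φ ξ ^ 2 + ψ ξ ^ 2)) * (M * mu ξ ^ γ) ^ 2 := by gcongr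
    have q3 : 0 ≤ M ^ 2 * (mu ξ ^ 2 * φ ξ ^ 2) := by positivity
    have q4 : 0 ≤ mu ξ ^ 2 * (mu ξ ^ γ) ^ 2 * (φ ξ ^ 2 + ψ ξ ^ 2) := by positivity
    nlinarith
  have hs2 := (hs1.add hsum).mul_left (2 + 4 * M ^ 2)
  have hs3 : Summable (fun ξ => f ξ ^ 2) :=
    Summable.of_nonneg_of_le (fun ξ => sq_nonneg _) hle hs2
  refine ⟨hs3, ?_⟩
  rw [← hs1.tsum_add hsum, ← tsum_mul_left]
  exact hs3.tsum_le_tsum hle hs2
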